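/- Let F be a field, n a natural number, and V_0, V_1, …, V_{2n} finite-dimensional F-vector spaces with linear maps L : V_i → V_{i+2} (for 0 ≤ i ≤ 2n−2) such that for each 0 ≤ i ≤ n the (n−i)-fold composite L^{n−i} : V_i → V_{2n−i} is a linear isomorphism. Then for every 2 ≤ i ≤ n, V_i is the internal direct sum of the primitive subspace P_i := ker(L^{n−i+1} : V_i → V_{2n−i+2}) and the image L(V_{i−2}); that is, V_i = P_i + L(V_{i−2}) and P_i ∩ L(V_{i−2}) = 0. Moreover, for i = 0 and i = 1 one has V_i = P_i. -/

import Mathlib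

/-- If `L` raises the degree by two, then `L ^ k` raises it by `2 * k`. -/
theorem pow_apply_mem_of_map_le {F W : Type*} [Semiring F] [AddCommMonoid W] [Module F W]
    {V : ℕ → Submodule F W} {L : W →ₗ[F] W} (hL : ∀ i, Submodule.map L (V i) ≤ V (i + 2))
    (k : ℕ) {i : ℕ} {x : W} (hx : x ∈ V i) : (L ^ k) x ∈ V (i + 2 * k) := by
  induction k with
  | zero => simpa using hx
  | succ k ih =>
    rw [pow_succ', Module.End.mul_apply]
    exact hL _ (Submodule.mem_map_of_mem ih)


/-- primitive decomposition step for a Lefschetz system.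
A Lefschetz system over a field `F` is encoded by finite-dimensional graded pieces
`V i` of an ambient `F`-vector space `W` (with `V i = ⊥` for `i > 2n`), together with a
Lefschetz operator `L` with `L (V i) ⊆ V (i + 2)`, such that for all `i ≤ n` the iterate
`L^(n-i)` maps `V i` bijectively onto `V (2n - i)` (hard Lefschetz).
The primitive subspace is `P i := V i ⊓ ker (L^(n-i+1))`.
Then for `2 ≤ i ≤ n` we have `V i = P i + L (V (i-2))` with `P i ⊓ L (V (i-2)) = ⊥`,
and for `i = 0, 1` we have `V i = P i`. -/
theorem statement0
    {F W : Type*} [Field F] [AddCommGroup W] [Module F W]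
    (n : ℕ) (V : ℕ → Submodule F W) [∀ i, FiniteDimensional F (V i)]
    (L : W →ₗ[F] W)
    (hL : ∀ i, Submodule.map L (V i) ≤ V (i + 2))
    (htriv : ∀ i, 2 * n < i → V i = ⊥)
    (hHL : ∀ i ≤ n, (∀ x ∈ V i, (L ^ (n - i)) x = 0 → x = 0) ∧
      Submodule.map (L ^ (n - i)) (V i) = V (2 * n - i)) :
    (∀ i, 2 ≤ i → i ≤ n →
      V i = (V i ⊓ LinearMap.ker (L ^ (n - i + 1))) ⊔ Submodule.map L (V (i - 2)) ∧
      (V i ⊓ LinearMap.ker (L ^ (n - i + 1))) ⊓ Submodule.map L (V (i - 2)) = ⊥) ∧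
    (∀ i ≤ 1, V i = V i ⊓ LinearMap.ker (L ^ (n - i + 1))) := by
  refine ⟨fun i hi hin => ?_, fun i hi => ?_⟩
  · obtain ⟨j, rfl⟩ := Nat.exists_eq_add_of_le' hi
    obtain ⟨hinj, hsurj⟩ := hHL j (by omega)
    have hpow : n - j = n - (j + 2) + 1 + 1 := by omega
    rw [hpow] at hinj hsurj
    rw [Nat.add_sub_cancel]
    constructor
    · refine le_antisymm (fun x hx => ?_) (sup_le inf_le_left (hL j))
      have hmem := pow_apply_mem_of_map_le hL (n - (j + 2) + 1) hx
      rw [show j + 2 + 2 * (n - (j + 2) + 1) = 2 * n - j by omega, ← hsurj] at hmem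
      obtain ⟨y, hy, hxy⟩ := hmem
      rw [pow_succ, Module.End.mul_apply] at hxy
      have hLy : L y ∈ Submodule.map L (V j) := Submodule.mem_map_of_mem hy
      refine Submodule.mem_sup.2 ⟨x - L y, ⟨sub_mem hx (hL j hLy), ?_⟩, L y, hLy,
        sub_add_cancel x (L y)⟩
      rw [SetLike.mem_coe, LinearMap.mem_ker, map_sub, hxy, sub_self]
    · rw [eq_bot_iff]
      rintro _ ⟨⟨-, hker⟩, y, hy, rfl⟩
      rw [SetLike.mem_coe, LinearMap.mem_ker, ← Module.End.mul_apply, ← pow_succ] at hker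
      rw [hinj y hy hker, map_zero]
      exact zero_mem _
  · refine (inf_eq_left.2 fun x hx => ?_).symm
    have hmem := pow_apply_mem_of_map_le hL (n - i + 1) hx
    rwa [htriv _ (by omega), Submodule.mem_bot] at hmem
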